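/- arXiv:1504.04879 — 2 statements merged into one kernel-verified Lean document; each statement's English description precedes it below -/
import Mathlib

section
/- In R = MvPolynomial (Fin 8) ℤ, the second elementary symmetric function of the multiset W((2,2,2), 8) of weights of semistandard Young tableaux of shape (2,2,2) with entries in {0,…,7} is congruent to 700·e₂ modulo the ideal generated by e₁; equivalently, c₂(γ₈^{(2,2,2)}) = 700·c₂(γ₈), the Table 1 entry for the weight 2α₃ of SL₈/μ₂. -/
open MvPolynomial

open scoped Classical in
/-- The multiset `W(lam, n)` of weights of semistandard Young tableaux of shape
`lam` (a list of row lengths) with entries in `{0, …, n-1}`: a tableau assigns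
to each cell `(i, j)` of the Young diagram of `lam` an entry in `Fin n`, weakly
increasing along rows and strictly increasing down columns; its weight is the
sum `∑_{(i,j) ∈ lam} X_{T(i,j)}`. -/
noncomputable def ssytWeights (lam : List ℕ) (n : ℕ) :
    Multiset (MvPolynomial (Fin n) ℤ) :=
  ((Finset.univ : Finset ((i : Fin lam.length) → Fin (lam.get i) → Fin n)).filter
      (fun T =>
        (∀ (i : Fin lam.length) (j j' : Fin (lam.get i)), (j : ℕ) ≤ (j' : ℕ) → T i j ≤ T i j') ∧
        (∀ (i i' : Fin lam.length), (i : ℕ) < (i' : ℕ) →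
          ∀ (j : Fin (lam.get i')) (hj : (j : ℕ) < lam.get i), T i ⟨j, hj⟩ < T i' j))).val.map
    (fun T => ∑ i, ∑ j, MvPolynomial.X (T i j))

/-- The second Newton identity for the elementary symmetric function of a multiset. -/
theorem Multiset.two_mul_esymm_two {R : Type*} [CommRing R] (s : Multiset R) :
    2 * s.esymm 2 = s.sum ^ 2 - (s.map (· ^ 2)).sum := by
  induction s using Multiset.induction_on with
  | empty => simp [Multiset.esymm, Multiset.powersetCard_zero_right]
  | cons a s ih =>
    have h : (a ::ₘ s).esymm 2 = s.esymm 2 + a * s.sum := by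
      simp [Multiset.esymm, Multiset.powersetCard_cons, Multiset.powersetCard_one,
        Multiset.map_map]
      simpa using Multiset.sum_map_mul_left (s := s) (a := a) (f := id)
    rw [h, mul_add, ih, Multiset.map_cons, Multiset.sum_cons, Multiset.sum_cons]
    ring

/-- Fillings of the shape `(2, 2, 2)`, encoded as the entries of the first column followed by
those of the second. -/
def fillingEquiv (α : Type*) :
    ((i : Fin [2, 2, 2].length) → Fin ([2, 2, 2].get i) → α) ≃ α × α × α × α × α × α where
  toFun T := (T ⟨0, by decide⟩ (0 : Fin 2), T ⟨1, by decide⟩ (0 : Fin 2),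
    T ⟨2, by decide⟩ (0 : Fin 2), T ⟨0, by decide⟩ (1 : Fin 2), T ⟨1, by decide⟩ (1 : Fin 2),
    T ⟨2, by decide⟩ (1 : Fin 2))
  invFun := fun (a, b, c, p, q, r) i => match i with
    | ⟨0, _⟩ => (![a, p] : Fin 2 → α)
    | ⟨1, _⟩ => (![b, q] : Fin 2 → α)
    | ⟨2, _⟩ => (![c, r] : Fin 2 → α)
  left_inv T := by
    funext i
    match i with
    | ⟨0, _⟩ => funext j; revert j; exact Fin.forall_fin_two.2 ⟨rfl, rfl⟩
    | ⟨1, _⟩ => funext j; revert j; exact Fin.forall_fin_two.2 ⟨rfl, rfl⟩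
    | ⟨2, _⟩ => funext j; revert j; exact Fin.forall_fin_two.2 ⟨rfl, rfl⟩
  right_inv _ := rfl

/-- Semistandardness of the filling with columns `a, b, c` and `p, q, r`. -/
def IsSemistandard {α : Type*} [LinearOrder α] : α × α × α × α × α × α → Prop
  | (a, b, c, p, q, r) =>
    a < b ∧ b < c ∧ a ≤ p ∧ (p < q ∧ b ≤ q) ∧ (q < r ∧ c ≤ r)

instance {α : Type*} [LinearOrder α] : DecidablePred (IsSemistandard (α := α)) := fun _ => by
  unfold IsSemistandard
  infer_instance

/-- The semistandard fillings of the shape `(2, 2, 2)`, encoded by their columns. -/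
def ssytFinset (n : ℕ) : Finset (Fin n × Fin n × Fin n × Fin n × Fin n × Fin n) :=
  Finset.univ.filter IsSemistandard

/-- The number of times `i` occurs among the six given entries. -/
def entryCount {α : Type*} [DecidableEq α] (i : α) : α × α × α × α × α × α → ℕ
  | (a, b, c, p, q, r) =>
    (if a = i then 1 else 0) + (if b = i then 1 else 0) + (if c = i then 1 else 0) +
      (if p = i then 1 else 0) + (if q = i then 1 else 0) + (if r = i then 1 else 0)

theorem isSemistandard_fillingEquiv_iff {α : Type*} [LinearOrder α]
    (T : (i : Fin [2, 2, 2].length) → Fin ([2, 2, 2].get i) → α) :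
    IsSemistandard (fillingEquiv α T) ↔
      (∀ (i : Fin [2, 2, 2].length) (j j' : Fin ([2, 2, 2].get i)), (j : ℕ) ≤ (j' : ℕ) →
        T i j ≤ T i j') ∧
      (∀ (i i' : Fin [2, 2, 2].length), (i : ℕ) < (i' : ℕ) →
        ∀ (j : Fin ([2, 2, 2].get i')) (hj : (j : ℕ) < [2, 2, 2].get i),
          T i ⟨j, hj⟩ < T i' j) := by
  constructor
  · rintro ⟨hab, hbc, ha, ⟨hpq, hb⟩, hqr, hc⟩
    constructor
    · intro i j j' h
      match i, j, j', h with
      | ⟨0, _⟩, ⟨0, _⟩, ⟨0, _⟩, _ => exact le_rfl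
      | ⟨0, _⟩, ⟨0, _⟩, ⟨1, _⟩, _ => exact ha
      | ⟨0, _⟩, ⟨1, _⟩, ⟨1, _⟩, _ => exact le_rfl
      | ⟨1, _⟩, ⟨0, _⟩, ⟨0, _⟩, _ => exact le_rfl
      | ⟨1, _⟩, ⟨0, _⟩, ⟨1, _⟩, _ => exact hb
      | ⟨1, _⟩, ⟨1, _⟩, ⟨1, _⟩, _ => exact le_rfl
      | ⟨2, _⟩, ⟨0, _⟩, ⟨0, _⟩, _ => exact le_rfl
      | ⟨2, _⟩, ⟨0, _⟩, ⟨1, _⟩, _ => exact hc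
      | ⟨2, _⟩, ⟨1, _⟩, ⟨1, _⟩, _ => exact le_rfl
    · intro i i' h j hj
      match i, i', h, j, hj with
      | ⟨0, _⟩, ⟨1, _⟩, _, j, _ =>
        match j with
        | ⟨0, _⟩ => exact hab
        | ⟨1, _⟩ => exact hpq
      | ⟨0, _⟩, ⟨2, _⟩, _, j, _ =>
        match j with
        | ⟨0, _⟩ => exact hab.trans hbc
        | ⟨1, _⟩ => exact hpq.trans hqr
      | ⟨1, _⟩, ⟨2, _⟩, _, j, _ =>
        match j with
        | ⟨0, _⟩ => exact hbc
        | ⟨1, _⟩ => exact hqr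
      | ⟨0, _⟩, ⟨0, _⟩, h, _, _ => exact absurd h (by simp)
      | ⟨1, _⟩, ⟨0, _⟩, h, _, _ => exact absurd h (by simp)
      | ⟨1, _⟩, ⟨1, _⟩, h, _, _ => exact absurd h (by simp)
      | ⟨2, _⟩, ⟨0, _⟩, h, _, _ => exact absurd h (by simp)
      | ⟨2, _⟩, ⟨1, _⟩, h, _, _ => exact absurd h (by simp)
      | ⟨2, _⟩, ⟨2, _⟩, h, _, _ => exact absurd h (by simp)
  · rintro ⟨hrow, hcol⟩
    have row (i) := hrow i ⟨0, by fin_cases i <;> decide⟩ ⟨1, by fin_cases i <;> decide⟩ zero_le_one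
    exact ⟨hcol ⟨0, by decide⟩ ⟨1, by decide⟩ zero_lt_one (0 : Fin 2) two_pos,
      hcol ⟨1, by decide⟩ ⟨2, by decide⟩ one_lt_two (0 : Fin 2) two_pos,
      row ⟨0, by decide⟩,
      ⟨hcol ⟨0, by decide⟩ ⟨1, by decide⟩ zero_lt_one (1 : Fin 2) one_lt_two,
        row ⟨1, by decide⟩⟩,
      hcol ⟨1, by decide⟩ ⟨2, by decide⟩ one_lt_two (1 : Fin 2) one_lt_two,
      row ⟨2, by decide⟩⟩

theorem sum_sum_filling {α M : Type*} [AddCommMonoid M]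
    (T : (i : Fin [2, 2, 2].length) → Fin ([2, 2, 2].get i) → α) (f : α → M) :
    ∑ i, ∑ j, f (T i j) = match fillingEquiv α T with
      | (a, b, c, p, q, r) => f a + f p + (f b + f q) + (f c + f r) := by
  refine (Fin.sum_univ_three (M := M) (fun i : Fin [2, 2, 2].length => ∑ j, f (T i j))).trans ?_
  have row (g : Fin 2 → α) :
      ∑ j, f (g j) = f (g 0) + f (g 1) := Fin.sum_univ_two _
  exact congrArg₂ (· + ·) (congrArg₂ (· + ·) (row (T ⟨0, by decide⟩))
    (row (T ⟨1, by decide⟩))) (row (T ⟨2, by decide⟩))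

theorem sum_entryCount_mul {α R : Type*} [Fintype α] [DecidableEq α] [CommRing R] (f : α → R)
    (x : α × α × α × α × α × α) :
    ∑ i, (entryCount i x : R) * f i = match x with
      | (a, b, c, p, q, r) => f a + f p + (f b + f q) + (f c + f r) := by
  obtain ⟨a, b, c, p, q, r⟩ := x
  simp only [entryCount, Nat.cast_add, Nat.cast_ite, Nat.cast_one, Nat.cast_zero, add_mul, ite_mul,
    one_mul, zero_mul, Finset.sum_add_distrib, Finset.sum_ite_eq, Finset.mem_univ, if_true]
  abel

theorem sum_map_ssytWeights {M : Type*} [AddCommMonoid M] (n : ℕ)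
    (φ : MvPolynomial (Fin n) ℤ → M) :
    ((ssytWeights [2, 2, 2] n).map φ).sum =
      ∑ x ∈ ssytFinset n, φ (∑ i, (entryCount i x : MvPolynomial (Fin n) ℤ) * X i) := by
  rw [ssytWeights, Multiset.map_map]
  refine Finset.sum_equiv (fillingEquiv (Fin n)) (fun T => ?_) (fun T _ => ?_)
  · rw [ssytFinset, Finset.mem_filter, Finset.mem_filter, isSemistandard_fillingEquiv_iff]
    simp only [Finset.mem_univ, true_and]
  · exact congrArg φ ((sum_sum_filling T X).trans (sum_entryCount_mul X _).symm)

/-- A sum over semistandard fillings as a nested sum that discards partial fillings early. -/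
theorem sum_ssytFinset {M : Type*} [AddCommMonoid M] (n : ℕ)
    (f : Fin n × Fin n × Fin n × Fin n × Fin n × Fin n → M) :
    ∑ x ∈ ssytFinset n, f x =
      ∑ a, ∑ b, if a < b then ∑ c, if b < c then ∑ p, if a ≤ p then
        ∑ q, if p < q ∧ b ≤ q then ∑ r, if q < r ∧ c ≤ r then f (a, b, c, p, q, r)
          else 0 else 0 else 0 else 0 else 0 := by
  have sum_ite {P : Prop} [Decidable P] (g : Fin n → M) :
      (if P then ∑ i, g i else 0) = ∑ i, if P then g i else 0 := by
    split_ifs <;> simp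
  simp only [ssytFinset, Finset.sum_filter, Fintype.sum_prod_type, IsSemistandard, ite_and, sum_ite]

theorem sum_entryCount (i : Fin 8) : ∑ x ∈ ssytFinset 8, entryCount i x = 882 := by
  rw [sum_ssytFinset]
  revert i
  decide +kernel

theorem sum_entryCount_mul_entryCount (i j : Fin 8) :
    ∑ x ∈ ssytFinset 8, entryCount i x * entryCount j x = 574 + if i = j then 700 else 0 := by
  rw [sum_ssytFinset]
  revert i j
  decide +kernel

theorem sum_ssytWeights :
    (ssytWeights [2, 2, 2] 8).sum = 882 * ∑ i, (X i : MvPolynomial (Fin 8) ℤ) := by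
  have h := sum_map_ssytWeights 8 id
  rw [Multiset.map_id] at h
  simp only [h, id_eq]
  rw [Finset.sum_comm, Finset.mul_sum]
  refine Finset.sum_congr rfl fun i _ => ?_
  rw [← Finset.sum_mul, ← Nat.cast_sum, sum_entryCount]
  norm_num

theorem sum_sq_ssytWeights :
    ((ssytWeights [2, 2, 2] 8).map (· ^ 2)).sum =
      574 * (∑ i, (X i : MvPolynomial (Fin 8) ℤ)) ^ 2 + 700 * ∑ i, X i ^ 2 := by
  have expand (x) : (∑ i, (entryCount i x : MvPolynomial (Fin 8) ℤ) * X i) ^ 2 =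
      ∑ i, ∑ j, ((entryCount i x * entryCount j x : ℕ) : MvPolynomial (Fin 8) ℤ) * (X i * X j) := by
    rw [sq, Finset.sum_mul_sum]
    refine Finset.sum_congr rfl fun i _ => Finset.sum_congr rfl fun j _ => ?_
    push_cast
    ring
  rw [sum_map_ssytWeights, Finset.sum_congr rfl fun x _ => expand x, Finset.sum_comm]
  simp_rw [Finset.sum_comm (s := ssytFinset 8), ← Finset.sum_mul, ← Nat.cast_sum,
    sum_entryCount_mul_entryCount]
  simp only [Nat.cast_add, Nat.cast_ite, Nat.cast_zero, Nat.cast_ofNat, add_mul, ite_mul, zero_mul,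
    Finset.sum_add_distrib, Finset.sum_ite_eq, Finset.mem_univ, if_true]
  simp only [← Finset.mul_sum, sq, Finset.sum_mul_sum]

/-- `c₂(γ8^[2, 2, 2]) = 700·c₂(γ8)`: the second elementary symmetric function of
the multiset of weights of semistandard Young tableaux of shape `[2, 2, 2]` with
entries in `{0, …, 7}` is congruent to `700·e₂` modulo the ideal generated
by `e₁`. -/
theorem c2_ssyt_stmt4 :
    Multiset.esymm (ssytWeights [2, 2, 2] 8) 2 - 700 * esymm (Fin 8) ℤ 2
      ∈ Ideal.span {esymm (Fin 8) ℤ 1} := by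
  have hW := Multiset.two_mul_esymm_two (ssytWeights [2, 2, 2] 8)
  have hX := Multiset.two_mul_esymm_two
    (Finset.univ.val.map (X : Fin 8 → MvPolynomial (Fin 8) ℤ))
  rw [sum_sq_ssytWeights, sum_ssytWeights] at hW
  rw [← esymm_eq_multiset_esymm, Multiset.map_map] at hX
  change 2 * esymm (Fin 8) ℤ 2 = (∑ i, X i) ^ 2 - ∑ i, X i ^ 2 at hX
  rw [Ideal.mem_span_singleton', esymm_one]
  refine ⟨388325 * ∑ i, X i, mul_left_cancel₀ (two_ne_zero' (MvPolynomial (Fin 8) ℤ)) ?_⟩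
  linear_combination 700 * hX - hW
end

section
/- In R = MvPolynomial (Fin 9) ℤ, the second elementary symmetric function of the multiset W((2,1), 9) of weights of semistandard Young tableaux of shape (2,1) with entries in {0,…,8} is congruent to 78·e₂ modulo the ideal generated by e₁; equivalently, c₂(γ₉^{(2,1)}) = 78·c₂(γ₉), the Table 2 entry for the weight α₁+α₂ of SL₉/μ₃. -/
open MvPolynomial

theorem Multiset.sum_sq_eq_sum_map_sq_add_two_mul_esymm_two {R : Type*} [CommRing R]
    (s : Multiset R) : s.sum ^ 2 = (s.map (· ^ 2)).sum + 2 * s.esymm 2 := by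
  induction s using Multiset.induction_on with
  | empty => simp [Multiset.esymm, Multiset.powersetCard_zero_right]
  | cons a s ih =>
    have h : (a ::ₘ s).esymm 2 = s.esymm 2 + a * s.sum := by
      simp [Multiset.esymm, Multiset.powersetCard_cons, Multiset.powersetCard_one]
      simpa using Multiset.sum_map_mul_left (s := s) (a := a) (f := id)
    rw [h, Multiset.sum_cons, Multiset.map_cons, Multiset.sum_cons]
    linear_combination ih

open scoped Classical in
/-- Triples `(a, b, c)` encoding the semistandard tableaux of shape `(2, 1)` with first row `a b`
and second row `c`. -/
noncomputable def hookTriples (n : ℕ) : Finset (Fin n × Fin n × Fin n) :=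
  Finset.univ.filter fun t => t.1 ≤ t.2.1 ∧ t.1 < t.2.2

theorem ssytWeights_two_one (n : ℕ) :
    ssytWeights [2, 1] n =
      (hookTriples n).val.map fun t => X t.1 + X t.2.1 + X t.2.2 := by
  classical
  let lam : List ℕ := [2, 1]
  let e : ((i : Fin lam.length) → Fin (lam.get i) → Fin n) → Fin n × Fin n × Fin n :=
    fun T => (T (0 : Fin 2) (0 : Fin 2), T (0 : Fin 2) (1 : Fin 2), T (1 : Fin 2) (0 : Fin 1))
  let g : Fin n × Fin n × Fin n → ((i : Fin lam.length) → Fin (lam.get i) → Fin n) :=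
    fun t => Fin.cons (α := fun i : Fin 2 => Fin (lam.get i) → Fin n)
      (![t.1, t.2.1] : Fin 2 → Fin n)
      (Fin.cons (α := fun i : Fin 1 => Fin (lam.get i.succ) → Fin n)
        (![t.2.2] : Fin 1 → Fin n) (fun i => i.elim0))
  have ge : ∀ T, g (e T) = T := by
    intro T
    funext (i : Fin 2) j
    fin_cases i
    · change Fin 2 at j
      fin_cases j <;> rfl
    · change Fin 1 at j
      fin_cases j; rfl
  have eg : ∀ t, e (g t) = t := fun t => rfl
  let E : ((i : Fin lam.length) → Fin (lam.get i) → Fin n) ≃ Fin n × Fin n × Fin n :=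
    ⟨e, g, ge, eg⟩
  have himg : hookTriples n = (Finset.univ.filter (fun T :
      (i : Fin lam.length) → Fin (lam.get i) → Fin n =>
        (∀ (i : Fin lam.length) (j j' : Fin (lam.get i)), (j : ℕ) ≤ (j' : ℕ) → T i j ≤ T i j') ∧
        (∀ (i i' : Fin lam.length), (i : ℕ) < (i' : ℕ) →
          ∀ (j : Fin (lam.get i')) (hj : (j : ℕ) < lam.get i),
            T i ⟨j, hj⟩ < T i' j))).map E.toEmbedding := by
    ext t
    obtain ⟨T, rfl⟩ := E.surjective t
    rw [Finset.mem_map_equiv, Equiv.symm_apply_apply, hookTriples, Finset.mem_filter,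
      Finset.mem_filter]
    simp only [Finset.mem_univ, true_and]
    constructor
    · rintro ⟨h₁, h₂⟩
      constructor
      · intro (i : Fin 2) j j' hj
        fin_cases i
        · change Fin 2 at j j'
          fin_cases j <;> fin_cases j'
          · exact le_rfl
          · exact h₁
          · exact absurd hj (by decide)
          · exact le_rfl
        · change Fin 1 at j j'
          fin_cases j; fin_cases j'
          exact le_rfl
      · intro (i : Fin 2) (i' : Fin 2) hi j hj
        fin_cases i <;> fin_cases i'
        · exact absurd hi (by decide)
        · change Fin 1 at j
          fin_cases j
          exact h₂
        · exact absurd hi (by decide)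
        · exact absurd hi (by decide)
    · rintro ⟨h₁, h₂⟩
      exact ⟨h₁ (0 : Fin 2) (0 : Fin 2) (1 : Fin 2) (by decide),
        h₂ (0 : Fin 2) (1 : Fin 2) (by decide) (0 : Fin 1) (by decide)⟩
  rw [himg, Finset.map_val, Multiset.map_map]
  refine Multiset.map_congr rfl fun T _ => ?_
  change ∑ i : Fin 2, _ = _
  rw [Fin.sum_univ_two]
  change ∑ j : Fin 2, X (T (0 : Fin 2) j) + ∑ j : Fin 1, X (T (1 : Fin 2) j) = _
  rw [Fin.sum_univ_two, Fin.sum_univ_one]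
  rfl

/-- Among the three cyclic rotations of a non-constant triple exactly one is a tableau. -/
theorem three_mul_sum_hookTriples {R : Type*} [CommRing R] {n : ℕ}
    (f : Fin n → Fin n → Fin n → R) (hf : ∀ a b c, f a b c = f b c a) :
    3 * ∑ t ∈ hookTriples n, f t.1 t.2.1 t.2.2 =
      ∑ a, ∑ b, ∑ c, f a b c - ∑ a, f a a a := by
  classical
  let F : Fin n → Fin n → Fin n → R := fun a b c => if a ≤ b ∧ a < c then f a b c else 0
  have hS : ∑ t ∈ hookTriples n, f t.1 t.2.1 t.2.2 = ∑ a, ∑ b, ∑ c, F a b c := by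
    rw [hookTriples, Finset.sum_filter, Fintype.sum_prod_type]
    simp only [Fintype.sum_prod_type, F]
  have h₁ : ∑ a, ∑ b, ∑ c, F b c a = ∑ a, ∑ b, ∑ c, F a b c := by
    rw [Finset.sum_comm]
    exact Finset.sum_congr rfl fun _ _ => Finset.sum_comm
  have h₂ : ∑ a, ∑ b, ∑ c, F c a b = ∑ a, ∑ b, ∑ c, F a b c := by
    rw [Finset.sum_congr rfl fun _ _ => Finset.sum_comm]
    exact Finset.sum_comm
  have hd : ∑ a, f a a a = ∑ a, ∑ b, ∑ c, if a = b ∧ a = c then f a b c else 0 := by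
    simp [ite_and]
  have hp : ∀ a b c, f a b c =
      F a b c + F b c a + F c a b + if a = b ∧ a = c then f a b c else 0 := by
    intro a b c
    simp only [F, ← hf a b c, hf c a b]
    split_ifs <;> first | omega | simp
  have h : ∑ a, ∑ b, ∑ c, f a b c = ∑ a, ∑ b, ∑ c, F a b c + ∑ a, ∑ b, ∑ c, F b c a +
      ∑ a, ∑ b, ∑ c, F c a b + ∑ a, f a a a := by
    rw [hd]
    simp only [← Finset.sum_add_distrib]
    exact Finset.sum_congr rfl fun a _ => Finset.sum_congr rfl fun b _ =>
      Finset.sum_congr rfl fun c _ => hp a b c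
  rw [h₁, h₂] at h
  rw [hS]
  linear_combination -h

theorem sum_sum_sum_add_add {R : Type*} [CommRing R] {n : ℕ} (x : Fin n → R) :
    ∑ a, ∑ b, ∑ c, (x a + x b + x c) = 3 * (n : R) ^ 2 * ∑ a, x a := by
  simp only [Finset.sum_add_distrib, Finset.sum_const, Finset.card_univ, Fintype.card_fin,
    nsmul_eq_mul, ← Finset.mul_sum]
  ring

theorem sum_sum_sum_add_add_sq {R : Type*} [CommRing R] {n : ℕ} (x : Fin n → R) :
    ∑ a, ∑ b, ∑ c, (x a + x b + x c) ^ 2 =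
      3 * (n : R) ^ 2 * ∑ a, x a ^ 2 + 6 * n * (∑ a, x a) ^ 2 := by
  have h : ∀ a b c, (x a + x b + x c) ^ 2 = x a ^ 2 + x b ^ 2 + x c ^ 2 +
      2 * (x a * x b) + 2 * (x a * x c) + 2 * (x b * x c) := fun a b c => by ring
  simp only [h, Finset.sum_add_distrib, Finset.sum_const, Finset.card_univ, Fintype.card_fin,
    nsmul_eq_mul, ← Finset.mul_sum, ← Finset.sum_mul]
  ring

/-- `c₂(γ9^[2, 1]) = 78·c₂(γ9)`: the second elementary symmetric function of
the multiset of weights of semistandard Young tableaux of shape `[2, 1]` with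
entries in `{0, …, 8}` is congruent to `78·e₂` modulo the ideal generated
by `e₁`. -/
theorem c2_ssyt_stmt13 :
    Multiset.esymm (ssytWeights [2, 1] 9) 2 - 78 * esymm (Fin 9) ℤ 2
      ∈ Ideal.span {esymm (Fin 9) ℤ 1} := by
  have hx := Multiset.sum_sq_eq_sum_map_sq_add_two_mul_esymm_two
    ((Finset.univ : Finset (Fin 9)).val.map (X : Fin 9 → MvPolynomial (Fin 9) ℤ))
  have hw := Multiset.sum_sq_eq_sum_map_sq_add_two_mul_esymm_two (ssytWeights [2, 1] 9)
  rw [← esymm_eq_multiset_esymm, Multiset.map_map] at hx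
  change (∑ a, X a) ^ 2 = ∑ a, X a ^ 2 + _ at hx
  rw [ssytWeights_two_one, Multiset.map_map] at hw
  change (∑ t ∈ hookTriples 9, (X t.1 + X t.2.1 + X t.2.2)) ^ 2 =
    ∑ t ∈ hookTriples 9, (X t.1 + X t.2.1 + X t.2.2) ^ 2 + _ at hw
  rw [← ssytWeights_two_one] at hw
  have h₁ := three_mul_sum_hookTriples
    (fun a b c : Fin 9 => (X a + X b + X c : MvPolynomial (Fin 9) ℤ)) (fun a b c => by ring)
  have h₂ := three_mul_sum_hookTriples
    (fun a b c : Fin 9 => (X a + X b + X c : MvPolynomial (Fin 9) ℤ) ^ 2) (fun a b c => by ring)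
  have hd₁ : ∑ a : Fin 9, (X a + X a + X a : MvPolynomial (Fin 9) ℤ) = 3 * ∑ a, X a := by
    rw [Finset.mul_sum]
    exact Finset.sum_congr rfl fun a _ => by ring
  have hd₂ : ∑ a : Fin 9, (X a + X a + X a : MvPolynomial (Fin 9) ℤ) ^ 2 =
      9 * ∑ a, X a ^ 2 := by
    rw [Finset.mul_sum]
    exact Finset.sum_congr rfl fun a _ => by ring
  simp only [sum_sum_sum_add_add, hd₁] at h₁
  simp only [sum_sum_sum_add_add_sq, hd₂] at h₂
  push_cast at h₁ h₂
  rw [Ideal.mem_span_singleton, esymm_one]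
  refine ⟨3152 * ∑ a, X a, ?_⟩
  generalize (∑ t ∈ hookTriples 9, (X t.1 + X t.2.1 + X t.2.2 : MvPolynomial (Fin 9) ℤ)) = s
    at hw h₁
  have h3 : (3 : MvPolynomial (Fin 9) ℤ) ≠ 0 := by norm_num
  have hs : s = 80 * ∑ a, X a :=
    mul_left_cancel₀ h3 (by linear_combination h₁)
  rw [hs] at hw
  have h6 : (6 : MvPolynomial (Fin 9) ℤ) ≠ 0 := by norm_num
  exact mul_left_cancel₀ h6 (by linear_combination -3 * hw - h₂ + 234 * hx)
end
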